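/- Let G be a finite simple graph having at least one fractional perfect matching. Then f_f(G) is a half integer, i.e., there exists an integer k ≥ 0 such that f_f(G) = k/2. -/

import Mathlib

open Finset

variable {V : Type} [Fintype V] [DecidableEq V]

/-- The sum of `γ` over the edges of `G` incident with the vertex `v`.
(Functions on `E(G)` are encoded as functions on `Sym2 V` vanishing off the edge set.) -/
def vertexSum (G : SimpleGraph V) [DecidableRel G.Adj] (γ : Sym2 V → ℝ) (v : V) : ℝ :=
  ∑ e ∈ G.edgeFinset, if v ∈ e then γ e else 0

/-- `γ` is a fractional perfect matching of `G`. -/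
def IsFPM (G : SimpleGraph V) [DecidableRel G.Adj] (γ : Sym2 V → ℝ) : Prop :=
  (∀ e, 0 ≤ γ e) ∧ (∀ e ∉ G.edgeSet, γ e = 0) ∧ ∀ v, vertexSum G γ v = 1

/-- `α ↑ γ` : `α` is a (nonnegative) forcing function for the fractional perfect matching
`γ`, i.e. `α ⪯ γ` and `γ` is the unique fractional perfect matching `γ'` with `α ⪯ γ'`. -/
def IsForcing (G : SimpleGraph V) [DecidableRel G.Adj] (α γ : Sym2 V → ℝ) : Prop :=
  (∀ e, 0 ≤ α e) ∧ (∀ e ∉ G.edgeSet, α e = 0) ∧ α ≤ γ ∧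
    ∀ γ', IsFPM G γ' → α ≤ γ' → γ' = γ

/-- `|α|`, the sum of the values of `α` over all edges of `G`. -/
def eSum (G : SimpleGraph V) [DecidableRel G.Adj] (α : Sym2 V → ℝ) : ℝ :=
  ∑ e ∈ G.edgeFinset, α e

/-- The fractional forcing number `f_f(G,γ) = min {|α| : α ↑ γ}`. -/
noncomputable def ffN (G : SimpleGraph V) [DecidableRel G.Adj] (γ : Sym2 V → ℝ) : ℝ :=
  sInf {x : ℝ | ∃ α, IsForcing G α γ ∧ x = eSum G α}

/-- `f_f(G)`, the minimum of `f_f(G,γ)` over all fractional perfect matchings `γ`. -/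
noncomputable def ffMin (G : SimpleGraph V) [DecidableRel G.Adj] : ℝ :=
  sInf {x : ℝ | ∃ γ, IsFPM G γ ∧ ffN G γ = x}

/-- `F_f(G)`, the maximum of `f_f(G,γ)` over all fractional perfect matchings `γ`. -/
noncomputable def ffMax (G : SimpleGraph V) [DecidableRel G.Adj] : ℝ :=
  sSup {x : ℝ | ∃ γ, IsFPM G γ ∧ ffN G γ = x}

theorem vertexSum_eq_sum_of_eq_zero (G : SimpleGraph V) [DecidableRel G.Adj] {γ : Sym2 V → ℝ}
    (h : ∀ e ∉ G.edgeSet, γ e = 0) (v : V) : vertexSum G γ v = ∑ u, γ s(v, u) := by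
  have h1 : vertexSum G γ v = ∑ e : Sym2 V, if v ∈ e then γ e else 0 := by
    refine Finset.sum_subset (Finset.subset_univ _) fun e _ he => ?_
    rw [h e (by simpa using he), ite_self]
  have h2 : (univ.filter fun e : Sym2 V => v ∈ e) = univ.image fun u => s(v, u) := by
    ext e
    simp [Sym2.mem_iff_exists, eq_comm]
  rw [h1, ← Finset.sum_filter, h2, Finset.sum_image]
  intro a _ b _ hab
  exact Sym2.congr_right.1 hab

/-- The function on unordered pairs whose matrix is the symmetrization of the permutation
matrix of `σ`. -/
noncomputable def permHalfMatching {W : Type*} [DecidableEq W] (σ : Equiv.Perm W) : Sym2 W → ℝ :=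
  Sym2.lift ⟨fun u v => ((if σ u = v then 1 else 0) + (if σ v = u then 1 else 0)) / 2,
    fun u v => by simp only [add_comm]⟩

theorem permHalfMatching_mk {W : Type*} [DecidableEq W] (σ : Equiv.Perm W) (u v : W) :
    permHalfMatching σ s(u, v) =
      ((if σ u = v then 1 else 0) + (if σ v = u then 1 else 0)) / 2 := rfl

theorem exists_nat_permHalfMatching {W : Type*} [DecidableEq W] (σ : Equiv.Perm W)
    (e : Sym2 W) :
    ∃ k : ℕ, permHalfMatching σ e = (k : ℝ) / 2 := by
  induction e with
  | _ u v =>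
    refine ⟨(if σ u = v then 1 else 0) + (if σ v = u then 1 else 0), ?_⟩
    rw [permHalfMatching_mk]
    push_cast
    rfl

theorem exists_nat_sum_permHalfMatching {W : Type*} [DecidableEq W] (σ : Equiv.Perm W)
    (T : Finset (Sym2 W)) :
    ∃ k : ℕ, ∑ e ∈ T, permHalfMatching σ e = (k : ℝ) / 2 := by
  choose k hk using exists_nat_permHalfMatching σ
  refine ⟨∑ e ∈ T, k e, ?_⟩
  push_cast
  rw [Finset.sum_div]
  exact Finset.sum_congr rfl fun e _ => hk e

theorem isFPM_permHalfMatching (G : SimpleGraph V) [DecidableRel G.Adj] {σ : Equiv.Perm V}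
    (hσ : ∀ u, G.Adj u (σ u)) : IsFPM G (permHalfMatching σ) := by
  have h0 : ∀ e ∉ G.edgeSet, permHalfMatching σ e = 0 := by
    intro e he
    induction e with
    | _ u v =>
      rw [SimpleGraph.mem_edgeSet] at he
      have h1 : σ u ≠ v := fun h => he (h ▸ hσ u)
      have h2 : σ v ≠ u := fun h => he (h ▸ hσ v).symm
      simp [permHalfMatching_mk, h1, h2]
  refine ⟨fun e => ?_, h0, fun v => ?_⟩
  · obtain ⟨k, hk⟩ := exists_nat_permHalfMatching σ e
    rw [hk]
    positivity
  · rw [vertexSum_eq_sum_of_eq_zero G h0]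
    have h2 : ∀ u, σ u = v ↔ u = σ.symm v := fun u => (Equiv.eq_symm_apply σ).symm
    simp only [permHalfMatching_mk, ← Finset.sum_div, Finset.sum_add_distrib, h2]
    simp

/-- Every fractional perfect matching is a convex combination of the half-integral ones coming
from permutations along edges. -/
theorem IsFPM.exists_convex_combination (G : SimpleGraph V) [DecidableRel G.Adj]
    {γ : Sym2 V → ℝ} (hγ : IsFPM G γ) :
    ∃ w : Equiv.Perm V → ℝ, (∀ σ, 0 ≤ w σ) ∧ ∑ σ, w σ = 1 ∧
      (∀ σ, w σ ≠ 0 → ∀ u, G.Adj u (σ u)) ∧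
      ∀ e, γ e = ∑ σ, w σ * permHalfMatching σ e := by
  obtain ⟨hpos, hzero, hsum⟩ := hγ
  have hrow : ∀ v, ∑ u, γ s(v, u) = 1 := fun v => by
    rw [← vertexSum_eq_sum_of_eq_zero G hzero, hsum]
  have hM : (Matrix.of fun u v => γ s(u, v)) ∈ doublyStochastic ℝ V := by
    rw [mem_doublyStochastic_iff_sum]
    refine ⟨fun u v => hpos _, hrow, fun v => ?_⟩
    simp_rw [Matrix.of_apply, Sym2.eq_swap (b := v)]
    exact hrow v
  obtain ⟨w, hw0, hw1, hw⟩ := exists_eq_sum_perm_of_mem_doublyStochastic hM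
  have hent : ∀ u v, γ s(u, v) = ∑ σ, w σ * (if σ u = v then 1 else 0) := fun u v => by
    have := congrFun (congrFun hw u) v
    simp only [Matrix.of_apply, Matrix.sum_apply, Matrix.smul_apply, smul_eq_mul] at this
    rw [← this]
    refine Finset.sum_congr rfl fun σ _ => ?_
    simp [Equiv.Perm.permMatrix, PEquiv.toMatrix_apply]
  refine ⟨w, hw0, hw1, fun σ hσ u => ?_, fun e => ?_⟩
  · by_contra hadj
    have h1 := hent u (σ u)
    rw [hzero _ (by simpa using hadj), eq_comm, Finset.sum_eq_zero_iff_of_nonneg] at h1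
    · exact hσ (by simpa using h1 σ (mem_univ _))
    · intro τ _
      have := hw0 τ
      positivity
  · induction e with
    | _ u v =>
      have h : γ s(u, v) = (γ s(u, v) + γ s(v, u)) / 2 := by
        rw [Sym2.eq_swap (a := v)]
        ring
      rw [h, hent u v, hent v u, ← Finset.sum_add_distrib, Finset.sum_div]
      refine Finset.sum_congr rfl fun σ _ => ?_
      rw [permHalfMatching_mk]
      ring

theorem IsFPM.exists_half_integral_sum_le (G : SimpleGraph V) [DecidableRel G.Adj]
    {γ : Sym2 V → ℝ} (hγ : IsFPM G γ) (T : Finset (Sym2 V)) :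
    ∃ γ', IsFPM G γ' ∧ ∑ e ∈ T, γ' e ≤ ∑ e ∈ T, γ e ∧
      ∃ k : ℕ, ∑ e ∈ T, γ' e = (k : ℝ) / 2 := by
  obtain ⟨w, hw0, hw1, hwadj, hw⟩ := hγ.exists_convex_combination G
  suffices h : ∃ σ, w σ ≠ 0 ∧ ∑ e ∈ T, permHalfMatching σ e ≤ ∑ e ∈ T, γ e by
    obtain ⟨σ, hσ, hle⟩ := h
    exact ⟨_, isFPM_permHalfMatching G (hwadj σ hσ), hle, exists_nat_sum_permHalfMatching σ T⟩
  by_contra! hlt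
  have hsum : ∑ e ∈ T, γ e = ∑ σ, w σ * ∑ e ∈ T, permHalfMatching σ e := by
    simp_rw [hw, Finset.mul_sum]
    exact Finset.sum_comm
  have hle : ∀ σ, w σ * ∑ e ∈ T, γ e ≤ w σ * ∑ e ∈ T, permHalfMatching σ e := fun σ => by
    by_cases h : w σ = 0
    · simp [h]
    · exact mul_le_mul_of_nonneg_left (hlt σ h).le (hw0 σ)
  obtain ⟨σ, -, hσ⟩ : ∃ σ ∈ univ, w σ ≠ 0 :=
    Finset.exists_ne_zero_of_sum_ne_zero (by rw [hw1]; exact one_ne_zero)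
  have : ∑ σ, w σ * ∑ e ∈ T, γ e < ∑ σ, w σ * ∑ e ∈ T, permHalfMatching σ e :=
    Finset.sum_lt_sum (fun σ _ => hle σ) ⟨σ, mem_univ _,
      mul_lt_mul_of_pos_left (hlt σ hσ) ((hw0 σ).lt_of_ne' hσ)⟩
  rw [← hsum, ← Finset.sum_mul, hw1, one_mul] at this
  exact lt_irrefl _ this

theorem IsFPM.isForcing_self (G : SimpleGraph V) [DecidableRel G.Adj]
    {γ : Sym2 V → ℝ} (hγ : IsFPM G γ) : IsForcing G γ γ := by
  refine ⟨hγ.1, hγ.2.1, le_rfl, fun γ' hγ' hle => ?_⟩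
  ext e
  induction e with
  | _ u v =>
    have h := (hγ.2.2 u).trans (hγ'.2.2 u).symm
    rw [vertexSum_eq_sum_of_eq_zero G hγ.2.1, vertexSum_eq_sum_of_eq_zero G hγ'.2.1] at h
    exact ((Finset.sum_eq_sum_iff_of_le fun x _ => hle s(u, x)).1 h v (mem_univ _)).symm

theorem IsFPM.add_smul_sub (G : SimpleGraph V) [DecidableRel G.Adj]
    {γ γ₁ γ₂ : Sym2 V → ℝ} (hγ : IsFPM G γ) (h₁ : IsFPM G γ₁) (h₂ : IsFPM G γ₂) (ε : ℝ)
    (hpos : ∀ e, 0 ≤ γ e + ε * (γ₁ e - γ₂ e)) :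
    IsFPM G fun e => γ e + ε * (γ₁ e - γ₂ e) := by
  have h0 : ∀ e ∉ G.edgeSet, γ e + ε * (γ₁ e - γ₂ e) = 0 := fun e he => by
    rw [hγ.2.1 e he, h₁.2.1 e he, h₂.2.1 e he]
    ring
  refine ⟨hpos, h0, fun v => ?_⟩
  have e0 := hγ.2.2 v
  have e1 := h₁.2.2 v
  have e2 := h₂.2.2 v
  rw [vertexSum_eq_sum_of_eq_zero G hγ.2.1] at e0
  rw [vertexSum_eq_sum_of_eq_zero G h₁.2.1] at e1
  rw [vertexSum_eq_sum_of_eq_zero G h₂.2.1] at e2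
  rw [vertexSum_eq_sum_of_eq_zero G h0, Finset.sum_add_distrib, ← Finset.mul_sum,
    Finset.sum_sub_distrib, e0, e1, e2]
  ring

theorem exists_pos_forall_le_add_mul {ι : Type*} [Finite ι] (a b d : ι → ℝ)
    (h : ∀ i, a i < b i ∨ a i = b i ∧ 0 ≤ d i) : ∃ ε > 0, ∀ i, a i ≤ b i + ε * d i := by
  have hev : ∀ i, ∀ᶠ ε in nhdsWithin (0 : ℝ) (Set.Ioi 0), a i ≤ b i + ε * d i := fun i => by
    rcases h i with hlt | ⟨heq, hd⟩
    · have hc : Filter.Tendsto (fun ε : ℝ => b i + ε * d i) (nhds 0) (nhds (b i)) := by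
        have : Continuous fun ε : ℝ => b i + ε * d i := by fun_prop
        simpa using this.tendsto 0
      exact ((hc.mono_left nhdsWithin_le_nhds).eventually (lt_mem_nhds hlt)).mono
        fun _ => le_of_lt
    · filter_upwards [self_mem_nhdsWithin] with ε hε
      have := mul_nonneg (le_of_lt hε) hd
      linarith
  obtain ⟨ε, hε, hpos⟩ := ((Filter.eventually_all.2 hev).and self_mem_nhdsWithin).exists
  exact ⟨ε, hpos, hε⟩

/-- Whether `α` forces `γ` depends only on the set where `α` and `γ` agree: restricting any other
fractional perfect matching to that set yields a forcing function as well. -/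
theorem IsForcing.isForcing_restrict (G : SimpleGraph V) [DecidableRel G.Adj]
    {α γ γ' : Sym2 V → ℝ} (hα : IsForcing G α γ) (hγ : IsFPM G γ) (hγ' : IsFPM G γ') :
    IsForcing G (fun e => if α e = γ e then γ' e else 0) γ' := by
  refine ⟨fun e => ?_, fun e he => ?_, fun e => ?_, fun γ'' hγ'' hle => ?_⟩
  · have := hγ'.1 e
    positivity
  · simp [hγ'.2.1 e he]
  · have := hγ'.1 e
    dsimp only
    split_ifs <;> simp [this]
  · obtain ⟨ε, hε, hbound⟩ := exists_pos_forall_le_add_mul α γ (fun e => γ'' e - γ' e)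
      fun e => by
        by_cases h : α e = γ e
        · have := hle e
          simp only [h, if_true] at this
          exact Or.inr ⟨h, sub_nonneg.2 this⟩
        · exact Or.inl ((hα.2.2.1 e).lt_of_ne h)
    have := hα.2.2.2 _
      (hγ.add_smul_sub G hγ'' hγ' ε fun e => (hα.1 e).trans (hbound e)) hbound
    ext e
    have he := congrFun this e
    simp only [add_eq_left, mul_eq_zero, hε.ne', false_or] at he
    exact sub_eq_zero.1 he

theorem IsForcing.exists_half_integral_le (G : SimpleGraph V) [DecidableRel G.Adj]
    {α γ : Sym2 V → ℝ} (hα : IsForcing G α γ) (hγ : IsFPM G γ) :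
    ∃ k : ℕ, (k : ℝ) / 2 ≤ eSum G α ∧
      ∃ γ', IsFPM G γ' ∧ ∃ α', IsForcing G α' γ' ∧ eSum G α' = (k : ℝ) / 2 := by
  obtain ⟨γ', hγ', hle, k, hk⟩ :=
    hγ.exists_half_integral_sum_le G (G.edgeFinset.filter fun e => α e = γ e)
  refine ⟨k, ?_, γ', hγ', _, hα.isForcing_restrict G hγ hγ', ?_⟩
  · rw [← hk]
    refine hle.trans ?_
    rw [← Finset.sum_congr rfl fun e he => (Finset.mem_filter.1 he).2]
    exact Finset.sum_le_sum_of_subset_of_nonneg (Finset.filter_subset _ _) fun e _ _ => hα.1 e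
  · rw [← hk, Finset.sum_filter]
    rfl

theorem IsForcing.eSum_nonneg (G : SimpleGraph V) [DecidableRel G.Adj]
    {α γ : Sym2 V → ℝ} (hα : IsForcing G α γ) : 0 ≤ eSum G α :=
  Finset.sum_nonneg fun e _ => hα.1 e

/-- `f_f(G)` is a half integer. -/
theorem ffMin_half_integer (G : SimpleGraph V) [DecidableRel G.Adj]
    (hne : ∃ γ, IsFPM G γ) :
    ∃ k : ℕ, ffMin G = (k : ℝ) / 2 := by
  classical
  have hex : ∃ k : ℕ, ∃ γ, IsFPM G γ ∧ ∃ α, IsForcing G α γ ∧ eSum G α = (k : ℝ) / 2 := by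
    obtain ⟨γ, hγ⟩ := hne
    obtain ⟨k, -, h⟩ := (hγ.isForcing_self G).exists_half_integral_le G hγ
    exact ⟨k, h⟩
  have hmin : ∀ γ, IsFPM G γ → ∀ α, IsForcing G α γ → (Nat.find hex : ℝ) / 2 ≤ eSum G α := by
    intro γ hγ α hα
    obtain ⟨k, hk, h⟩ := hα.exists_half_integral_le G hγ
    have : (Nat.find hex : ℝ) ≤ k := by exact_mod_cast Nat.find_min' hex h
    linarith
  have hffN : ∀ γ, IsFPM G γ → (Nat.find hex : ℝ) / 2 ≤ ffN G γ := by
    intro γ hγ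
    refine le_csInf ⟨_, γ, hγ.isForcing_self G, rfl⟩ ?_
    rintro _ ⟨α, hα, rfl⟩
    exact hmin γ hγ α hα
  obtain ⟨γ, hγ, α, hα, hsum⟩ := Nat.find_spec hex
  have hγmin : ffN G γ = (Nat.find hex : ℝ) / 2 := by
    refine le_antisymm ?_ (hffN γ hγ)
    rw [← hsum]
    refine csInf_le ⟨0, ?_⟩ ⟨α, hα, rfl⟩
    rintro _ ⟨β, hβ, rfl⟩
    exact hβ.eSum_nonneg G
  refine ⟨Nat.find hex, IsLeast.csInf_eq ⟨⟨γ, hγ, hγmin⟩, ?_⟩⟩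
  rintro _ ⟨γ', hγ', rfl⟩
  exact hffN γ' hγ'
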